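/- arXiv:math/0607512 — 2 statements merged into one kernel-verified Lean document; each statement's English description precedes it below -/
import Mathlib

section
/- For every integer r ≥ 1, the graph L_r is a cubic graph with 20r + 34 vertices, γ(L_r) = 7r + 12, L_r has exactly r + 1 bridges (so L_r is connected but not 2-connected), and γ(L_r) > ⌈(20r + 34)/3⌉. -/
open SimpleGraph

/-- `D` is a dominating set of `G`. -/
def IsDomSet {V : Type*} (G : SimpleGraph V) (D : Set V) : Prop :=
  ∀ v : V, v ∉ D → ∃ u ∈ D, G.Adj u v

/-- The domination number of `G`. -/
noncomputable def domNum {V : Type*} (G : SimpleGraph V) : ℕ :=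
  sInf {n : ℕ | ∃ D : Set V, IsDomSet G D ∧ D.ncard = n}

/-- A graph is cubic if every vertex has degree three. -/
def IsCubic {V : Type*} (G : SimpleGraph V) : Prop :=
  ∀ v : V, Nat.card (G.neighborSet v) = 3

/-- The graph `A`: `K₃₃` with the edges `u1w1`, `u1w2` subdivided by `a1 = 6`, `a2 = 7`.
Vertices: `u1,u2,u3 = 0,1,2`, `w1,w2,w3 = 3,4,5`, `a1 = 6`, `a2 = 7`. -/
def graphA : SimpleGraph (Fin 8) :=
  SimpleGraph.fromEdgeSet
    {s(6, 0), s(6, 3), s(7, 0), s(7, 4), s(0, 5),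
     s(1, 3), s(1, 4), s(1, 5), s(2, 3), s(2, 4), s(2, 5)}

/-- The graph `B`: `K₃₃` with the edges `u1w1`, `u1w2`, `u1w3` subdivided by
`b1 = 6`, `b2 = 7`, `b3 = 8`. -/
def graphB : SimpleGraph (Fin 9) :=
  SimpleGraph.fromEdgeSet
    {s(6, 0), s(6, 3), s(7, 0), s(7, 4), s(8, 0), s(8, 5),
     s(1, 3), s(1, 4), s(1, 5), s(2, 3), s(2, 4), s(2, 5)}

/-- The rooted graph `F2(H, {h1, h2})`: two disjoint copies of `H`, four new vertices
`x = 0`, `y = 1`, `z1 = 2`, `z2 = 3`, and the edges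
`x1x, xz1, z1y, yy1, x2z2, z2y2, z1z2`; distinguished vertices `x` and `y`. -/
def F2graph {V : Type*} (H : SimpleGraph V) (h1 h2 : V) :
    SimpleGraph ((V ⊕ V) ⊕ Fin 4) :=
  SimpleGraph.fromRel (fun a b =>
    (∃ x y, H.Adj x y ∧ a = Sum.inl (Sum.inl x) ∧ b = Sum.inl (Sum.inl y)) ∨
    (∃ x y, H.Adj x y ∧ a = Sum.inl (Sum.inr x) ∧ b = Sum.inl (Sum.inr y)) ∨
    (a = Sum.inl (Sum.inl h1) ∧ b = Sum.inr 0) ∨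
    (a = Sum.inr 0 ∧ b = Sum.inr 2) ∨
    (a = Sum.inr 2 ∧ b = Sum.inr 1) ∨
    (a = Sum.inr 1 ∧ b = Sum.inl (Sum.inr h1)) ∨
    (a = Sum.inl (Sum.inl h2) ∧ b = Sum.inr 3) ∨
    (a = Sum.inr 3 ∧ b = Sum.inl (Sum.inr h2)) ∨
    (a = Sum.inr 2 ∧ b = Sum.inr 3))

/-- The rooted graph `(P, {p1, p2}) = F2(A, {a1, a2})`, with `p1 = Sum.inr 0`, `p2 = Sum.inr 1`. -/
def graphP : SimpleGraph ((Fin 8 ⊕ Fin 8) ⊕ Fin 4) := F2graph graphA 6 7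

/-- The rooted graph `T1(H, {h1, h2})`: two disjoint copies of `(H, {h1,h2})`, one new vertex
`z1 = Sum.inr 0`, and the edges `x1z1`, `z1y1`, `x2y2`; the distinguished vertex is `s = z1`. -/
def SgraphOf {V : Type*} (H : SimpleGraph V) (h1 h2 : V) :
    SimpleGraph ((V ⊕ V) ⊕ Fin 1) :=
  SimpleGraph.fromRel (fun a b =>
    (∃ x y, H.Adj x y ∧ a = Sum.inl (Sum.inl x) ∧ b = Sum.inl (Sum.inl y)) ∨
    (∃ x y, H.Adj x y ∧ a = Sum.inl (Sum.inr x) ∧ b = Sum.inl (Sum.inr y)) ∨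
    (a = Sum.inl (Sum.inl h1) ∧ b = Sum.inr 0) ∨
    (a = Sum.inr 0 ∧ b = Sum.inl (Sum.inr h1)) ∨
    (a = Sum.inl (Sum.inl h2) ∧ b = Sum.inl (Sum.inr h2)))

/-- The rooted graph `(S, s)` built from two copies of `(A, {a1, a2})`; `s = Sum.inr 0`. -/
def graphS : SimpleGraph ((Fin 8 ⊕ Fin 8) ⊕ Fin 1) := SgraphOf graphA 6 7

/-- The 20-vertex type of `P`; `p1 = Sum.inr 0`, `p2 = Sum.inr 1`. -/
abbrev VP : Type := (Fin 8 ⊕ Fin 8) ⊕ Fin 4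

/-- The 17-vertex type of `S`; `s = Sum.inr 0`. -/
abbrev VS : Type := (Fin 8 ⊕ Fin 8) ⊕ Fin 1

/-- The graph `L_r`: the path `(v_1, …, v_{2r})` with each edge `v_{2i−1} v_{2i}` replaced by a
disjoint copy of `(P, {p1, p2})` (so `v_{2i−1}` becomes `p1` of copy `i` and `v_{2i}` becomes
`p2` of copy `i`, the surviving path edges joining `p2` of copy `i` to `p1` of copy `i+1`),
together with two disjoint copies `(S_1, s_1)`, `(S_2, s_2)` of `(S, s)` and the two additional
edges `s_1 v_1` and `s_2 v_{2r}`. -/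
def Lgraph (r : ℕ) : SimpleGraph ((Fin r × VP) ⊕ (VS ⊕ VS)) :=
  SimpleGraph.fromRel (fun a b =>
    (∃ (i : Fin r) (x y : VP), graphP.Adj x y ∧
      a = Sum.inl (i, x) ∧ b = Sum.inl (i, y)) ∨
    (∃ i j : Fin r, (j : ℕ) = (i : ℕ) + 1 ∧
      a = Sum.inl (i, Sum.inr 1) ∧ b = Sum.inl (j, Sum.inr 0)) ∨
    (∃ x y : VS, graphS.Adj x y ∧ a = Sum.inr (Sum.inl x) ∧ b = Sum.inr (Sum.inl y)) ∨
    (∃ x y : VS, graphS.Adj x y ∧ a = Sum.inr (Sum.inr x) ∧ b = Sum.inr (Sum.inr y)) ∨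
    (∃ i : Fin r, (i : ℕ) = 0 ∧
      a = Sum.inr (Sum.inl (Sum.inr 0)) ∧ b = Sum.inl (i, Sum.inr 0)) ∨
    (∃ i : Fin r, (i : ℕ) = r - 1 ∧
      a = Sum.inr (Sum.inr (Sum.inr 0)) ∧ b = Sum.inl (i, Sum.inr 1)))

/-! ### Neighbour lists -/

instance decMemP (x : VP) (l : List VP) : Decidable (x ∈ l) :=
  decidable_of_iff (l.any (fun y => decide (y = x)) = true) (by simp)

instance decMemS (x : VS) (l : List VS) : Decidable (x ∈ l) :=
  decidable_of_iff (l.any (fun y => decide (y = x)) = true) (by simp)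

def nbA : Fin 8 → List (Fin 8) :=
  ![[6, 7, 5], [3, 4, 5], [3, 4, 5], [6, 1, 2], [7, 1, 2], [0, 1, 2], [0, 3], [0, 4]]

def nbP : VP → List VP
  | Sum.inl (Sum.inl x) => (nbA x).map (fun t => Sum.inl (Sum.inl t)) ++
      (if x = 6 then [Sum.inr 0] else if x = 7 then [Sum.inr 3] else [])
  | Sum.inl (Sum.inr x) => (nbA x).map (fun t => Sum.inl (Sum.inr t)) ++
      (if x = 6 then [Sum.inr 1] else if x = 7 then [Sum.inr 3] else [])
  | Sum.inr z => (![[Sum.inl (Sum.inl 6), Sum.inr 2], [Sum.inl (Sum.inr 6), Sum.inr 2],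
      [Sum.inr 0, Sum.inr 1, Sum.inr 3],
      [Sum.inl (Sum.inl 7), Sum.inl (Sum.inr 7), Sum.inr 2]] : Fin 4 → List VP) z

def nbS : VS → List VS
  | Sum.inl (Sum.inl x) => (nbA x).map (fun t => Sum.inl (Sum.inl t)) ++
      (if x = 6 then [Sum.inr 0] else if x = 7 then [Sum.inl (Sum.inr 7)] else [])
  | Sum.inl (Sum.inr x) => (nbA x).map (fun t => Sum.inl (Sum.inr t)) ++
      (if x = 6 then [Sum.inr 0] else if x = 7 then [Sum.inl (Sum.inl 7)] else [])
  | Sum.inr _ => [Sum.inl (Sum.inl 6), Sum.inl (Sum.inr 6)]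

lemma graphA_adj (a b : Fin 8) : graphA.Adj a b ↔ b ∈ nbA a := by
  simp only [graphA, fromEdgeSet_adj, Set.mem_insert_iff, Set.mem_singleton_iff, Sym2.eq_iff]
  revert a b
  decide +kernel

lemma graphP_adj (a b : VP) : graphP.Adj a b ↔ b ∈ nbP a := by
  simp only [graphP, F2graph, fromRel_adj, graphA_adj]
  rcases a with (a | a) | a <;> rcases b with (b | b) | b <;> simp [nbP]
  all_goals
    revert a b
    decide +kernel

lemma graphS_adj (a b : VS) : graphS.Adj a b ↔ b ∈ nbS a := by
  simp only [graphS, SgraphOf, fromRel_adj, graphA_adj]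
  rcases a with (a | a) | a <;> rcases b with (b | b) | b <;> simp [nbS]
  all_goals
    revert a b
    decide +kernel
/-! ### Local domination bounds -/

set_option synthInstance.maxHeartbeats 400000 in
set_option synthInstance.maxSize 2000 in
set_option maxHeartbeats 1000000 in
lemma domA_aux : ∀ b0 b1 b2 b3 b4 b5 b6 b7 : Bool,
    (b0 || b6 || b7 || b5) = true → (b1 || b3 || b4 || b5) = true →
    (b2 || b3 || b4 || b5) = true → (b3 || b6 || b1 || b2) = true →
    (b4 || b7 || b1 || b2) = true → (b5 || b0 || b1 || b2) = true →
    2 ≤ b0.toNat + b1.toNat + b2.toNat + b3.toNat + b4.toNat + b5.toNat + b6.toNat + b7.toNat ∧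
    (b0.toNat + b1.toNat + b2.toNat + b3.toNat + b4.toNat + b5.toNat + b6.toNat + b7.toNat ≤ 2 →
      (b6 || b0 || b3) = false ∧ (b7 || b0 || b4) = false) := by
  decide +kernel

lemma domA (d : Fin 8 → Bool) (h : ∀ x, x ≠ 6 → x ≠ 7 → (d x || (nbA x).any d) = true) :
    2 ≤ ∑ x, (d x).toNat ∧ (∑ x, (d x).toNat ≤ 2 →
      (d 6 || d 0 || d 3) = false ∧ (d 7 || d 0 || d 4) = false) := by
  have := domA_aux (d 0) (d 1) (d 2) (d 3) (d 4) (d 5) (d 6) (d 7)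
  simp only [Fin.sum_univ_eight]
  apply this
  · simpa [nbA, or_assoc] using h 0 (by decide) (by decide)
  · simpa [nbA, or_assoc] using h 1 (by decide) (by decide)
  · simpa [nbA, or_assoc] using h 2 (by decide) (by decide)
  · simpa [nbA, or_assoc] using h 3 (by decide) (by decide)
  · simpa [nbA, or_assoc] using h 4 (by decide) (by decide)
  · simpa [nbA, or_assoc] using h 5 (by decide) (by decide)

lemma domP (d : VP → Bool)
    (h : ∀ x, x ≠ Sum.inr 0 → x ≠ Sum.inr 1 → (d x || (nbP x).any d) = true) :
    7 ≤ ∑ x, (d x).toNat := by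
  have hX := domA (fun x => d (Sum.inl (Sum.inl x))) (by
    intro x h6 h7
    have := h (Sum.inl (Sum.inl x)) (by simp) (by simp)
    simpa [nbP, h6, h7] using this)
  have hY := domA (fun x => d (Sum.inl (Sum.inr x))) (by
    intro x h6 h7
    have := h (Sum.inl (Sum.inr x)) (by simp) (by simp)
    simpa [nbP, h6, h7] using this)
  have hx6 := h (Sum.inl (Sum.inl 6)) (by simp) (by simp)
  have hx7 := h (Sum.inl (Sum.inl 7)) (by simp) (by simp)
  have hy6 := h (Sum.inl (Sum.inr 6)) (by simp) (by simp)
  have hy7 := h (Sum.inl (Sum.inr 7)) (by simp) (by simp)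
  have hz := h (Sum.inr 2) (by simp) (by simp)
  simp only [Fintype.sum_sum_type, Fin.sum_univ_four]
  generalize (∑ x, (d (Sum.inl (Sum.inl x))).toNat) = sx at *
  generalize (∑ x, (d (Sum.inl (Sum.inr x))).toNat) = sy at *
  simp [nbP, nbA] at hx6 hx7 hy6 hy7 hz hX hY
  clear h
  obtain ⟨hX, hX'⟩ := hX
  obtain ⟨hY, hY'⟩ := hY
  by_cases cx : sx ≤ 2 <;> by_cases cy : sy ≤ 2
  · have hX' := hX' cx
    have hY' := hY' cy
    simp_all
    omega
  · have hX' := hX' cx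
    simp_all
    omega
  · have hY' := hY' cy
    simp_all
    omega
  · rcases hz with hz | hz | hz | hz <;> simp only [hz, Bool.toNat_true] <;> omega

lemma domS (d : VS → Bool)
    (h : ∀ x, x ≠ Sum.inr 0 → (d x || (nbS x).any d) = true) :
    6 ≤ ∑ x, (d x).toNat := by
  have hX := domA (fun x => d (Sum.inl (Sum.inl x))) (by
    intro x h6 h7
    have := h (Sum.inl (Sum.inl x)) (by simp)
    simpa [nbS, h6, h7] using this)
  have hY := domA (fun x => d (Sum.inl (Sum.inr x))) (by
    intro x h6 h7
    have := h (Sum.inl (Sum.inr x)) (by simp)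
    simpa [nbS, h6, h7] using this)
  have hx6 := h (Sum.inl (Sum.inl 6)) (by simp)
  have hx7 := h (Sum.inl (Sum.inl 7)) (by simp)
  have hy6 := h (Sum.inl (Sum.inr 6)) (by simp)
  have hy7 := h (Sum.inl (Sum.inr 7)) (by simp)
  simp only [Fintype.sum_sum_type, Fin.sum_univ_one]
  generalize (∑ x, (d (Sum.inl (Sum.inl x))).toNat) = sx at *
  generalize (∑ x, (d (Sum.inl (Sum.inr x))).toNat) = sy at *
  simp [nbS, nbA] at hx6 hx7 hy6 hy7 hX hY
  clear h
  obtain ⟨hX, hX'⟩ := hX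
  obtain ⟨hY, hY'⟩ := hY
  by_cases cx : sx ≤ 2 <;> by_cases cy : sy ≤ 2
  · have hX' := hX' cx
    have hY' := hY' cy
    simp_all
  · have hX' := hX' cx
    simp_all
    omega
  · have hY' := hY' cy
    simp_all
    omega
  · omega

/-! ### Depth-limited search -/

/-- `srch nb ok n u v`: is there a walk of length at most `n` from `u` to `v`
following `nb` through steps allowed by `ok`? -/
def srch {V : Type} [DecidableEq V] (nb : V → List V) (ok : V → V → Bool) :
    ℕ → V → V → Bool
  | 0, u, v => decide (u = v)
  | n + 1, u, v => decide (u = v) || (nb u).any (fun w => ok u w && srch nb ok n w v)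

lemma srch_sound {V : Type} [DecidableEq V] (nb : V → List V) (ok : V → V → Bool)
    (R : V → V → Prop) (hrefl : ∀ v, R v v)
    (hstep : ∀ u w v, w ∈ nb u → ok u w = true → R w v → R u v) :
    ∀ n u v, srch nb ok n u v = true → R u v := by
  intro n
  induction n with
  | zero => intro u v h; simp [srch] at h; subst h; exact hrefl u
  | succ n ih =>
    intro u v h
    simp [srch] at h
    rcases h with h | ⟨w, h1, h2, h3⟩
    · subst h; exact hrefl u
    · exact hstep u w v h1 h2 (ih w v h3)

def okE {V : Type} [DecidableEq V] (a b : V) (u w : V) : Bool :=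
  !(decide (u = a ∧ w = b) || decide (u = b ∧ w = a))

lemma detP : ∀ u, ∀ v ∈ nbP u, srch nbP (okE u v) 5 u v = true := by decide +kernel
lemma detS : ∀ u, ∀ v ∈ nbS u, srch nbS (okE u v) 6 u v = true := by decide +kernel
lemma conP : ∀ u, srch nbP (fun _ _ => true) 7 u (Sum.inr 0) = true := by decide +kernel
lemma conS : ∀ u, srch nbS (fun _ _ => true) 7 u (Sum.inr 0) = true := by decide +kernel

lemma degP : ∀ x : VP, x ≠ Sum.inr 0 → x ≠ Sum.inr 1 → (nbP x).toFinset.card = 3 := by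
  decide +kernel
lemma degP0 : (nbP (Sum.inr 0)).toFinset.card = 2 := by decide +kernel
lemma degP1 : (nbP (Sum.inr 1)).toFinset.card = 2 := by decide +kernel
lemma degS : ∀ x : VS, x ≠ Sum.inr 0 → (nbS x).toFinset.card = 3 := by decide +kernel
lemma degS0 : (nbS (Sum.inr 0)).toFinset.card = 2 := by decide +kernel

/-! ### Structure of `L_r` -/

abbrev VL (r : ℕ) : Type := (Fin r × VP) ⊕ (VS ⊕ VS)

/-- Left end of the `k`-th connecting edge. -/
def lft {r : ℕ} (k : Fin (r + 1)) : VL r :=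
  Fin.cases (motive := fun _ => VL r) (Sum.inr (Sum.inl (Sum.inr 0)))
    (fun i => Sum.inl (i, Sum.inr 1)) k

/-- Right end of the `k`-th connecting edge. -/
def rgt {r : ℕ} (k : Fin (r + 1)) : VL r :=
  Fin.lastCases (motive := fun _ => VL r) (Sum.inr (Sum.inr (Sum.inr 0)))
    (fun i => Sum.inl (i, Sum.inr 0)) k

lemma lft_zero {r : ℕ} : (lft (0 : Fin (r + 1)) : VL r) = Sum.inr (Sum.inl (Sum.inr 0)) := rfl

lemma lft_succ {r : ℕ} (i : Fin r) : (lft i.succ : VL r) = Sum.inl (i, Sum.inr 1) := rfl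

lemma rgt_last {r : ℕ} : (rgt (Fin.last r) : VL r) = Sum.inr (Sum.inr (Sum.inr 0)) := by
  simp [rgt]

lemma rgt_castSucc {r : ℕ} (i : Fin r) : (rgt i.castSucc : VL r) = Sum.inl (i, Sum.inr 0) := by
  simp [rgt]

def lev {r : ℕ} : VL r → ℕ
  | Sum.inl (i, _) => i + 1
  | Sum.inr (Sum.inl _) => 0
  | Sum.inr (Sum.inr _) => r + 1

lemma lev_lft {r : ℕ} (k : Fin (r + 1)) : lev (lft k : VL r) = k := by
  refine Fin.cases ?_ (fun i => ?_) k
  · simp [lft_zero, lev]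
  · simp [lft_succ, lev]

lemma lev_rgt {r : ℕ} (k : Fin (r + 1)) : lev (rgt k : VL r) = k + 1 := by
  refine Fin.lastCases ?_ (fun i => ?_) k
  · simp [rgt_last, lev]
  · simp [rgt_castSucc, lev]

lemma inl_eq_lft {r : ℕ} (k : Fin (r + 1)) (i : Fin r) (x : VP) :
    Sum.inl (i, x) = (lft k : VL r) ↔ x = Sum.inr 1 ∧ k = i.succ := by
  refine Fin.cases ?_ (fun j => ?_) k
  · simp [lft_zero, (Fin.succ_ne_zero i).symm]
  · simp only [lft_succ, Sum.inl.injEq, Prod.mk.injEq, Fin.succ_inj]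
    tauto

lemma inl_eq_rgt {r : ℕ} (k : Fin (r + 1)) (i : Fin r) (x : VP) :
    Sum.inl (i, x) = (rgt k : VL r) ↔ x = Sum.inr 0 ∧ k = i.castSucc := by
  refine Fin.lastCases ?_ (fun j => ?_) k
  · simp [rgt_last, (Fin.castSucc_ne_last i).symm]
  · simp only [rgt_castSucc, Sum.inl.injEq, Prod.mk.injEq, Fin.castSucc_inj]
    tauto

lemma inr_inl_eq_lft {r : ℕ} (k : Fin (r + 1)) (x : VS) :
    Sum.inr (Sum.inl x) = (lft k : VL r) ↔ x = Sum.inr 0 ∧ k = 0 := by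
  refine Fin.cases ?_ (fun j => ?_) k
  · simp [lft_zero]
  · simp [lft_succ]

lemma inr_inr_eq_lft {r : ℕ} (k : Fin (r + 1)) (x : VS) :
    ¬ Sum.inr (Sum.inr x) = (lft k : VL r) := by
  refine Fin.cases ?_ (fun j => ?_) k
  · simp [lft_zero]
  · simp [lft_succ]

lemma inr_inr_eq_rgt {r : ℕ} (k : Fin (r + 1)) (x : VS) :
    Sum.inr (Sum.inr x) = (rgt k : VL r) ↔ x = Sum.inr 0 ∧ k = Fin.last r := by
  refine Fin.lastCases ?_ (fun j => ?_) k
  · simp [rgt_last]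
  · simp [rgt_castSucc]

lemma inr_inl_eq_rgt {r : ℕ} (k : Fin (r + 1)) (x : VS) :
    ¬ Sum.inr (Sum.inl x) = (rgt k : VL r) := by
  refine Fin.lastCases ?_ (fun j => ?_) k
  · simp [rgt_last]
  · simp [rgt_castSucc]

def Intra {r : ℕ} (a b : VL r) : Prop :=
  (∃ (i : Fin r) (x y : VP), y ∈ nbP x ∧ a = Sum.inl (i, x) ∧ b = Sum.inl (i, y)) ∨
  (∃ x y : VS, y ∈ nbS x ∧ a = Sum.inr (Sum.inl x) ∧ b = Sum.inr (Sum.inl y)) ∨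
  (∃ x y : VS, y ∈ nbS x ∧ a = Sum.inr (Sum.inr x) ∧ b = Sum.inr (Sum.inr y))

lemma nbP_symm {x y : VP} (h : y ∈ nbP x) : x ∈ nbP y := by
  rw [← graphP_adj] at *; exact h.symm

lemma nbS_symm {x y : VS} (h : y ∈ nbS x) : x ∈ nbS y := by
  rw [← graphS_adj] at *; exact h.symm

lemma nbP_ne {x y : VP} (h : y ∈ nbP x) : x ≠ y := by
  rw [← graphP_adj] at *; exact h.ne

lemma nbS_ne {x y : VS} (h : y ∈ nbS x) : x ≠ y := by
  rw [← graphS_adj] at *; exact h.ne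

lemma Intra.symm {r : ℕ} {a b : VL r} (h : Intra a b) : Intra b a := by
  rcases h with ⟨i, x, y, h, rfl, rfl⟩ | ⟨x, y, h, rfl, rfl⟩ | ⟨x, y, h, rfl, rfl⟩
  · exact Or.inl ⟨i, y, x, nbP_symm h, rfl, rfl⟩
  · exact Or.inr (Or.inl ⟨y, x, nbS_symm h, rfl, rfl⟩)
  · exact Or.inr (Or.inr ⟨y, x, nbS_symm h, rfl, rfl⟩)

lemma Intra.lev_eq {r : ℕ} {a b : VL r} (h : Intra a b) : lev a = lev b := by
  rcases h with ⟨i, x, y, h, rfl, rfl⟩ | ⟨x, y, h, rfl, rfl⟩ | ⟨x, y, h, rfl, rfl⟩ <;> rfl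

lemma Intra.ne {r : ℕ} {a b : VL r} (h : Intra a b) : a ≠ b := by
  rcases h with ⟨i, x, y, h, rfl, rfl⟩ | ⟨x, y, h, rfl, rfl⟩ | ⟨x, y, h, rfl, rfl⟩
  · simpa using nbP_ne h
  · simpa using nbS_ne h
  · simpa using nbS_ne h

def LRel {r : ℕ} (a b : VL r) : Prop :=
  Intra a b ∨ (∃ k, a = lft k ∧ b = rgt k) ∨ (∃ k, b = lft k ∧ a = rgt k)

lemma LRel.symm {r : ℕ} {a b : VL r} (h : LRel a b) : LRel b a := by
  rcases h with h | h | h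
  · exact Or.inl h.symm
  · exact Or.inr (Or.inr h)
  · exact Or.inr (Or.inl h)

lemma L_adj_of_link {r : ℕ} (hr : 1 ≤ r) (k : Fin (r + 1)) :
    (Lgraph r).Adj (lft k) (rgt k) := by
  unfold Lgraph
  rw [fromRel_adj]
  refine ⟨fun h => ?_, ?_⟩
  · have := congrArg lev h
    rw [lev_lft, lev_rgt] at this
    omega
  · refine Fin.cases ?_ (fun i => ?_) k
    · left
      have h0 : (0 : Fin (r + 1)) = (⟨0, hr⟩ : Fin r).castSucc := rfl
      refine Or.inr (Or.inr (Or.inr (Or.inr (Or.inl ⟨⟨0, hr⟩, rfl, lft_zero, ?_⟩))))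
      rw [h0, rgt_castSucc]
    · by_cases h : (i : ℕ) + 1 < r
      · left
        have h0 : i.succ = (⟨i + 1, h⟩ : Fin r).castSucc := rfl
        refine Or.inr (Or.inl ⟨i, ⟨i + 1, h⟩, rfl, lft_succ i, ?_⟩)
        rw [h0, rgt_castSucc]
      · right
        have h0 : i.succ = Fin.last r := by
          apply Fin.ext
          simp
          omega
        refine Or.inr (Or.inr (Or.inr (Or.inr (Or.inr ⟨i, by omega, ?_, lft_succ i⟩))))
        rw [h0, rgt_last]

lemma L_adj {r : ℕ} (hr : 1 ≤ r) (a b : VL r) : (Lgraph r).Adj a b ↔ LRel a b := by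
  constructor
  · have key : ∀ a b : VL r, ((∃ (i : Fin r) (x y : VP), graphP.Adj x y ∧
      a = Sum.inl (i, x) ∧ b = Sum.inl (i, y)) ∨
    (∃ i j : Fin r, (j : ℕ) = (i : ℕ) + 1 ∧
      a = Sum.inl (i, Sum.inr 1) ∧ b = Sum.inl (j, Sum.inr 0)) ∨
    (∃ x y : VS, graphS.Adj x y ∧ a = Sum.inr (Sum.inl x) ∧ b = Sum.inr (Sum.inl y)) ∨
    (∃ x y : VS, graphS.Adj x y ∧ a = Sum.inr (Sum.inr x) ∧ b = Sum.inr (Sum.inr y)) ∨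
    (∃ i : Fin r, (i : ℕ) = 0 ∧
      a = Sum.inr (Sum.inl (Sum.inr 0)) ∧ b = Sum.inl (i, Sum.inr 0)) ∨
    (∃ i : Fin r, (i : ℕ) = r - 1 ∧
      a = Sum.inr (Sum.inr (Sum.inr 0)) ∧ b = Sum.inl (i, Sum.inr 1))) → LRel a b := by
      intro a b h
      rcases h with ⟨i, x, y, h, ha, hb⟩ | ⟨i, j, h, rfl, rfl⟩ | ⟨x, y, h, ha, hb⟩ |
        ⟨x, y, h, ha, hb⟩ | ⟨i, h, rfl, rfl⟩ | ⟨i, h, rfl, rfl⟩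
      · exact Or.inl (Or.inl ⟨i, x, y, (graphP_adj _ _).1 h, ha, hb⟩)
      · refine Or.inr (Or.inl ⟨i.succ, rfl, ?_⟩)
        rw [inl_eq_rgt]
        exact ⟨rfl, Fin.ext (by simp [h])⟩
      · exact Or.inl (Or.inr (Or.inl ⟨x, y, (graphS_adj _ _).1 h, ha, hb⟩))
      · exact Or.inl (Or.inr (Or.inr ⟨x, y, (graphS_adj _ _).1 h, ha, hb⟩))
      · refine Or.inr (Or.inl ⟨0, rfl, ?_⟩)
        rw [inl_eq_rgt]
        exact ⟨rfl, Fin.ext (by simp [h])⟩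
      · refine Or.inr (Or.inr ⟨i.succ, rfl, ?_⟩)
        rw [inr_inr_eq_rgt]
        exact ⟨rfl, Fin.ext (by simp [h]; omega)⟩
    intro h
    unfold Lgraph at h
    rw [fromRel_adj] at h
    rcases h.2 with h | h
    · exact key a b h
    · exact (key b a h).symm
  · rintro (h | ⟨k, rfl, rfl⟩ | ⟨k, rfl, rfl⟩)
    · unfold Lgraph
      rw [fromRel_adj]
      refine ⟨h.ne, Or.inl ?_⟩
      rcases h with ⟨i, x, y, h, ha, hb⟩ | ⟨x, y, h, ha, hb⟩ | ⟨x, y, h, ha, hb⟩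
      · exact Or.inl ⟨i, x, y, (graphP_adj _ _).2 h, ha, hb⟩
      · exact Or.inr (Or.inr (Or.inl ⟨x, y, (graphS_adj _ _).2 h, ha, hb⟩))
      · exact Or.inr (Or.inr (Or.inr (Or.inl ⟨x, y, (graphS_adj _ _).2 h, ha, hb⟩)))
    · exact L_adj_of_link hr k
    · exact (L_adj_of_link hr k).symm

lemma adj_P {r : ℕ} (hr : 1 ≤ r) (i : Fin r) (x : VP) (w : VL r) :
    (Lgraph r).Adj (Sum.inl (i, x)) w ↔ (∃ y ∈ nbP x, Sum.inl (i, y) = w) ∨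
      (x = Sum.inr 1 ∧ w = rgt i.succ) ∨ (x = Sum.inr 0 ∧ w = lft i.castSucc) := by
  rw [L_adj hr, LRel, Intra]
  simp only [inl_eq_lft, inl_eq_rgt]
  constructor
  · rintro ((⟨j, x', y, h, h1, rfl⟩ | ⟨_, _, _, h1, _⟩ | ⟨_, _, _, h1, _⟩) |
      ⟨k, ⟨h1, rfl⟩, rfl⟩ | ⟨k, rfl, h1, rfl⟩)
    · simp at h1
      obtain ⟨rfl, rfl⟩ := h1
      exact Or.inl ⟨y, h, rfl⟩
    · simp at h1
    · simp at h1
    · exact Or.inr (Or.inl ⟨h1, rfl⟩)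
    · exact Or.inr (Or.inr ⟨h1, rfl⟩)
  · rintro (⟨y, h, rfl⟩ | ⟨rfl, rfl⟩ | ⟨rfl, rfl⟩)
    · exact Or.inl (Or.inl ⟨i, x, y, h, rfl, rfl⟩)
    · exact Or.inr (Or.inl ⟨_, ⟨rfl, rfl⟩, rfl⟩)
    · exact Or.inr (Or.inr ⟨_, rfl, rfl, rfl⟩)

lemma adj_S1 {r : ℕ} (hr : 1 ≤ r) (x : VS) (w : VL r) :
    (Lgraph r).Adj (Sum.inr (Sum.inl x)) w ↔ (∃ y ∈ nbS x, Sum.inr (Sum.inl y) = w) ∨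
      (x = Sum.inr 0 ∧ w = rgt 0) := by
  rw [L_adj hr, LRel, Intra]
  simp only [inr_inl_eq_lft, inr_inl_eq_rgt]
  constructor
  · rintro ((⟨_, _, _, _, h1, _⟩ | ⟨x', y, h, h1, rfl⟩ | ⟨_, _, _, h1, _⟩) |
      ⟨k, ⟨h1, rfl⟩, rfl⟩ | ⟨k, rfl, h1⟩)
    · simp at h1
    · simp at h1
      subst h1
      exact Or.inl ⟨y, h, rfl⟩
    · simp at h1
    · exact Or.inr ⟨h1, rfl⟩
    · exact h1.elim
  · rintro (⟨y, h, rfl⟩ | ⟨rfl, rfl⟩)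
    · exact Or.inl (Or.inr (Or.inl ⟨x, y, h, rfl, rfl⟩))
    · exact Or.inr (Or.inl ⟨_, ⟨rfl, rfl⟩, rfl⟩)

lemma adj_S2 {r : ℕ} (hr : 1 ≤ r) (x : VS) (w : VL r) :
    (Lgraph r).Adj (Sum.inr (Sum.inr x)) w ↔ (∃ y ∈ nbS x, Sum.inr (Sum.inr y) = w) ∨
      (x = Sum.inr 0 ∧ w = lft (Fin.last r)) := by
  rw [L_adj hr, LRel, Intra]
  simp only [inr_inr_eq_lft, inr_inr_eq_rgt]
  constructor
  · rintro ((⟨_, _, _, _, h1, _⟩ | ⟨_, _, _, h1, _⟩ | ⟨x', y, h, h1, rfl⟩) |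
      ⟨k, h1, _⟩ | ⟨k, rfl, h1, rfl⟩)
    · simp at h1
    · simp at h1
    · simp at h1
      subst h1
      exact Or.inl ⟨y, h, rfl⟩
    · exact h1.elim
    · exact Or.inr ⟨h1, rfl⟩
  · rintro (⟨y, h, rfl⟩ | ⟨rfl, rfl⟩)
    · exact Or.inl (Or.inr (Or.inr ⟨x, y, h, rfl, rfl⟩))
    · exact Or.inr (Or.inr ⟨_, rfl, rfl, rfl⟩)

/-! ### Cubic -/

lemma card_three_a {V W : Type} [DecidableEq W] (G : SimpleGraph V) (v : V) (e : W → V)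
    (he : Function.Injective e) (l : List W) (hl : l.toFinset.card = 3)
    (h : ∀ w, G.Adj v w ↔ ∃ y ∈ l, e y = w) : Nat.card (G.neighborSet v) = 3 := by
  have : G.neighborSet v = e '' (l.toFinset : Set W) := by
    ext w
    simp [h]
  rw [this, Nat.card_coe_set_eq, Set.ncard_image_of_injective _ he, Set.ncard_coe_finset, hl]

lemma card_three_b {V W : Type} [DecidableEq W] (G : SimpleGraph V) (v u : V) (e : W → V)
    (he : Function.Injective e) (l : List W) (hl : l.toFinset.card = 2) (hu : ∀ y, e y ≠ u)
    (h : ∀ w, G.Adj v w ↔ (∃ y ∈ l, e y = w) ∨ w = u) : Nat.card (G.neighborSet v) = 3 := by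
  have : G.neighborSet v = insert u (e '' (l.toFinset : Set W)) := by
    ext w
    simp [h, or_comm]
  rw [this, Nat.card_coe_set_eq, Set.ncard_insert_of_notMem (by simp; intro x _; exact hu x)
    (Set.toFinite _), Set.ncard_image_of_injective _ he, Set.ncard_coe_finset, hl]

lemma L_cubic {r : ℕ} (hr : 1 ≤ r) : IsCubic (Lgraph r) := by
  have hS1 : Function.Injective (fun y : VS => (Sum.inr (Sum.inl y) : VL r)) := by
    intro a b h; simpa using h
  have hS2 : Function.Injective (fun y : VS => (Sum.inr (Sum.inr y) : VL r)) := by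
    intro a b h; simpa using h
  have hP : ∀ i : Fin r, Function.Injective (fun y : VP => (Sum.inl (i, y) : VL r)) := by
    intro i a b h; simpa using h
  rintro (⟨i, x⟩ | x | x)
  · by_cases h0 : x = Sum.inr 0
    · subst h0
      refine card_three_b _ _ (lft i.castSucc) _ (hP i) _ degP0 (fun y h => ?_) (fun w => ?_)
      · have := congrArg lev h
        rw [lev_lft] at this
        simp [lev] at this
      · simp [adj_P hr]
    · by_cases h1 : x = Sum.inr 1
      · subst h1
        refine card_three_b _ _ (rgt i.succ) _ (hP i) _ degP1 (fun y h => ?_) (fun w => ?_)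
        · have := congrArg lev h
          rw [lev_rgt] at this
          simp [lev] at this
        · simp [adj_P hr]
      · refine card_three_a _ _ _ (hP i) _ (degP x h0 h1) (fun w => ?_)
        simp [adj_P hr, h0, h1]
  · by_cases h0 : x = Sum.inr 0
    · subst h0
      refine card_three_b _ _ (rgt 0) _ hS1 _ degS0 (fun y h => ?_) (fun w => ?_)
      · have := congrArg lev h
        rw [lev_rgt] at this
        simp [lev] at this
      · simp [adj_S1 hr]
    · refine card_three_a _ _ _ hS1 _ (degS x h0) (fun w => ?_)
      simp [adj_S1 hr, h0]
  · by_cases h0 : x = Sum.inr 0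
    · subst h0
      refine card_three_b _ _ (lft (Fin.last r)) _ hS2 _ degS0 (fun y h => ?_) (fun w => ?_)
      · have := congrArg lev h
        rw [lev_lft] at this
        simp [lev] at this
      · simp [adj_S2 hr]
    · refine card_three_a _ _ _ hS2 _ (degS x h0) (fun w => ?_)
      simp [adj_S2 hr, h0]

/-! ### Domination number -/

lemma ncard_eq_sum {V : Type} [Fintype V] (D : Set V) (d : V → Bool)
    (h : ∀ v, d v = true ↔ v ∈ D) : D.ncard = ∑ v, (d v).toNat := by
  classical
  have : D = ((Finset.univ.filter (fun v => d v = true) : Finset V) : Set V) := by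
    ext v; simp [h]
  rw [this, Set.ncard_coe_finset, Finset.card_filter]
  refine Finset.sum_congr rfl (fun v _ => ?_)
  cases d v <;> simp

lemma sum_VL {r : ℕ} (f : VL r → ℕ) : ∑ v, f v = ∑ i : Fin r, ∑ x, f (Sum.inl (i, x)) +
    (∑ x, f (Sum.inr (Sum.inl x)) + ∑ x, f (Sum.inr (Sum.inr x))) := by
  rw [Fintype.sum_sum_type, Fintype.sum_sum_type, Fintype.sum_prod_type]

lemma dom_lower {r : ℕ} (hr : 1 ≤ r) (D : Set (VL r)) (hD : IsDomSet (Lgraph r) D) :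
    7 * r + 12 ≤ D.ncard := by
  classical
  rw [ncard_eq_sum D (fun v => decide (v ∈ D)) (by simp), sum_VL]
  have h1 : ∀ i : Fin r, 7 ≤ ∑ x, (decide ((Sum.inl (i, x) : VL r) ∈ D)).toNat := by
    intro i
    apply domP (fun x => decide ((Sum.inl (i, x) : VL r) ∈ D))
    intro x hx0 hx1
    by_cases hx : (Sum.inl (i, x) : VL r) ∈ D
    · simp [hx]
    · obtain ⟨u, hu, ha⟩ := hD _ hx
      rw [SimpleGraph.adj_comm, adj_P hr] at ha
      simp only [hx0, hx1, false_and, or_false] at ha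
      obtain ⟨y, hy, rfl⟩ := ha
      simp only [hx, decide_false, Bool.false_or, List.any_eq_true, decide_eq_true_eq]
      exact ⟨y, hy, hu⟩
  have h2 : 6 ≤ ∑ x, (decide ((Sum.inr (Sum.inl x) : VL r) ∈ D)).toNat := by
    apply domS (fun x => decide ((Sum.inr (Sum.inl x) : VL r) ∈ D))
    intro x hx0
    by_cases hx : (Sum.inr (Sum.inl x) : VL r) ∈ D
    · simp [hx]
    · obtain ⟨u, hu, ha⟩ := hD _ hx
      rw [SimpleGraph.adj_comm, adj_S1 hr] at ha
      simp only [hx0, false_and, or_false] at ha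
      obtain ⟨y, hy, rfl⟩ := ha
      simp only [hx, decide_false, Bool.false_or, List.any_eq_true, decide_eq_true_eq]
      exact ⟨y, hy, hu⟩
  have h3 : 6 ≤ ∑ x, (decide ((Sum.inr (Sum.inr x) : VL r) ∈ D)).toNat := by
    apply domS (fun x => decide ((Sum.inr (Sum.inr x) : VL r) ∈ D))
    intro x hx0
    by_cases hx : (Sum.inr (Sum.inr x) : VL r) ∈ D
    · simp [hx]
    · obtain ⟨u, hu, ha⟩ := hD _ hx
      rw [SimpleGraph.adj_comm, adj_S2 hr] at ha
      simp only [hx0, false_and, or_false] at ha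
      obtain ⟨y, hy, rfl⟩ := ha
      simp only [hx, decide_false, Bool.false_or, List.any_eq_true, decide_eq_true_eq]
      exact ⟨y, hy, hu⟩
  have h4 := Finset.card_nsmul_le_sum Finset.univ
    (fun i : Fin r => ∑ x, (decide ((Sum.inl (i, x) : VL r) ∈ D)).toNat) 7 (fun i _ => h1 i)
  simp only [Finset.card_univ, Fintype.card_fin, smul_eq_mul] at h4
  omega

def dP (x : VP) : Bool := decide (x ∈ ([Sum.inl (Sum.inl 0), Sum.inl (Sum.inl 1),
  Sum.inl (Sum.inl 2), Sum.inl (Sum.inr 0), Sum.inl (Sum.inr 1), Sum.inl (Sum.inr 2),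
  Sum.inr 2] : List VP))

def dS (x : VS) : Bool := decide (x ∈ ([Sum.inl (Sum.inl 0), Sum.inl (Sum.inl 1),
  Sum.inl (Sum.inl 2), Sum.inl (Sum.inr 0), Sum.inl (Sum.inr 4), Sum.inl (Sum.inr 6)] : List VS))

lemma dP_dom : ∀ x, (dP x || (nbP x).any dP) = true := by decide +kernel
lemma dS_dom : ∀ x, (dS x || (nbS x).any dS) = true := by decide +kernel
lemma dP_sum : ∑ x, (dP x).toNat = 7 := by decide +kernel
lemma dS_sum : ∑ x, (dS x).toNat = 6 := by decide +kernel

def dL {r : ℕ} : VL r → Bool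
  | Sum.inl (_, x) => dP x
  | Sum.inr (Sum.inl x) => dS x
  | Sum.inr (Sum.inr x) => dS x

lemma dom_upper {r : ℕ} (hr : 1 ≤ r) :
    ∃ D : Set (VL r), IsDomSet (Lgraph r) D ∧ D.ncard = 7 * r + 12 := by
  refine ⟨{v | dL v = true}, ?_, ?_⟩
  · rintro (⟨i, x⟩ | x | x) hx
    · have h := dP_dom x
      have hx' : dP x = false := by simpa [dL] using hx
      simp only [hx', Bool.false_or, List.any_eq_true] at h
      obtain ⟨y, hy, hd⟩ := h
      exact ⟨Sum.inl (i, y), hd, ((adj_P hr _ _ _).2 (Or.inl ⟨y, hy, rfl⟩)).symm⟩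
    · have h := dS_dom x
      have hx' : dS x = false := by simpa [dL] using hx
      simp only [hx', Bool.false_or, List.any_eq_true] at h
      obtain ⟨y, hy, hd⟩ := h
      exact ⟨Sum.inr (Sum.inl y), hd, ((adj_S1 hr _ _).2 (Or.inl ⟨y, hy, rfl⟩)).symm⟩
    · have h := dS_dom x
      have hx' : dS x = false := by simpa [dL] using hx
      simp only [hx', Bool.false_or, List.any_eq_true] at h
      obtain ⟨y, hy, hd⟩ := h
      exact ⟨Sum.inr (Sum.inr y), hd, ((adj_S2 hr _ _).2 (Or.inl ⟨y, hy, rfl⟩)).symm⟩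
  · rw [ncard_eq_sum _ dL (by simp), sum_VL]
    simp only [dL, dP_sum, dS_sum, Finset.sum_const, Finset.card_univ, Fintype.card_fin,
      smul_eq_mul]
    omega

lemma L_domNum {r : ℕ} (hr : 1 ≤ r) : domNum (Lgraph r) = 7 * r + 12 := by
  apply le_antisymm
  · exact Nat.sInf_le (dom_upper hr)
  · refine le_csInf ⟨_, dom_upper hr⟩ ?_
    rintro n ⟨D, hD, rfl⟩
    exact dom_lower hr D hD

/-! ### Connectivity and bridges -/

lemma reach_emb {V W : Type} [DecidableEq W] (G : SimpleGraph V) (e : W → V) (nb : W → List W)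
    (ok : W → W → Bool) (h : ∀ u w, w ∈ nb u → ok u w = true → G.Adj (e u) (e w))
    (n : ℕ) (u v : W) (hs : srch nb ok n u v = true) : G.Reachable (e u) (e v) :=
  srch_sound nb ok (fun a b => G.Reachable (e a) (e b)) (fun _ => Reachable.refl _)
    (fun a b _ h1 h2 h3 => (h a b h1 h2).reachable.trans h3) n u v hs

lemma not_bridge_emb {V W : Type} [DecidableEq W] (G : SimpleGraph V) (e : W → V)
    (he : Function.Injective e) (nb : W → List W)
    (h : ∀ u w, w ∈ nb u → G.Adj (e u) (e w))
    (n : ℕ) (u v : W) (hs : srch nb (okE u v) n u v = true) : ¬ G.IsBridge s(e u, e v) := by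
  rw [isBridge_iff, not_not]
  refine reach_emb _ e nb (okE u v) (fun a b hab hok => ?_) n u v hs
  rw [deleteEdges_adj]
  refine ⟨h a b hab, ?_⟩
  simp [okE] at hok
  simp only [Set.mem_singleton_iff, Sym2.eq_iff, he.eq_iff]
  tauto

lemma L_connected {r : ℕ} (hr : 1 ≤ r) : (Lgraph r).Connected := by
  have hP : ∀ (i : Fin r) (x : VP),
      (Lgraph r).Reachable (Sum.inl (i, x)) (Sum.inl (i, Sum.inr 0)) := fun i x =>
    reach_emb (Lgraph r) (fun y => Sum.inl (i, y)) nbP _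
      (fun u w hw _ => (adj_P hr _ _ _).2 (Or.inl ⟨w, hw, rfl⟩)) 7 x (Sum.inr 0) (conP x)
  have hS1 : ∀ (x : VS),
      (Lgraph r).Reachable (Sum.inr (Sum.inl x)) (Sum.inr (Sum.inl (Sum.inr 0))) := fun x =>
    reach_emb (Lgraph r) (fun y => Sum.inr (Sum.inl y)) nbS _
      (fun u w hw _ => (adj_S1 hr _ _).2 (Or.inl ⟨w, hw, rfl⟩)) 7 x (Sum.inr 0) (conS x)
  have hS2 : ∀ (x : VS),
      (Lgraph r).Reachable (Sum.inr (Sum.inr x)) (Sum.inr (Sum.inr (Sum.inr 0))) := fun x =>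
    reach_emb (Lgraph r) (fun y => Sum.inr (Sum.inr y)) nbS _
      (fun u w hw _ => (adj_S2 hr _ _).2 (Or.inl ⟨w, hw, rfl⟩)) 7 x (Sum.inr 0) (conS x)
  have hk : ∀ k : Fin (r + 1), (Lgraph r).Reachable (lft k) (lft 0) := by
    intro k
    induction k using Fin.induction with
    | zero => exact Reachable.refl _
    | succ i ih =>
      rw [lft_succ]
      refine (hP i _).trans (Reachable.trans ?_ ih)
      rw [← rgt_castSucc]
      exact (L_adj_of_link hr _).symm.reachable
  have hk' : ∀ k : Fin (r + 1), (Lgraph r).Reachable (rgt k) (lft 0) := fun k =>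
    (L_adj_of_link hr k).symm.reachable.trans (hk k)
  have all : ∀ v : VL r, (Lgraph r).Reachable v (lft 0) := by
    rintro (⟨i, x⟩ | x | x)
    · refine (hP i x).trans ?_
      rw [← rgt_castSucc]
      exact hk' _
    · exact hS1 x
    · refine (hS2 x).trans ?_
      rw [← rgt_last]
      exact hk' _
  have : Nonempty (VL r) := ⟨lft 0⟩
  exact Connected.mk (fun u v => (all u).trans (all v).symm)

lemma reachable_closed {V : Type*} {G : SimpleGraph V} (S : Set V)
    (hS : ∀ a b, G.Adj a b → a ∈ S → b ∈ S) {a b : V} (h : G.Reachable a b) (ha : a ∈ S) :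
    b ∈ S := by
  obtain ⟨p⟩ := h
  induction p with
  | nil => exact ha
  | cons h p ih => exact ih (hS _ _ h ha)

lemma intra_not_bridge {r : ℕ} (hr : 1 ≤ r) {a b : VL r} (h : Intra a b) :
    ¬ (Lgraph r).IsBridge s(a, b) := by
  rcases h with ⟨i, x, y, h, rfl, rfl⟩ | ⟨x, y, h, rfl, rfl⟩ | ⟨x, y, h, rfl, rfl⟩
  · exact not_bridge_emb (Lgraph r) (fun y => Sum.inl (i, y)) (fun _ _ h => by simpa using h) nbP
      (fun u w hw => (adj_P hr _ _ _).2 (Or.inl ⟨w, hw, rfl⟩)) 5 x y (detP x y h)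
  · exact not_bridge_emb (Lgraph r) (fun y => Sum.inr (Sum.inl y)) (fun _ _ h => by simpa using h)
      nbS (fun u w hw => (adj_S1 hr _ _).2 (Or.inl ⟨w, hw, rfl⟩)) 6 x y (detS x y h)
  · exact not_bridge_emb (Lgraph r) (fun y => Sum.inr (Sum.inr y)) (fun _ _ h => by simpa using h)
      nbS (fun u w hw => (adj_S2 hr _ _).2 (Or.inl ⟨w, hw, rfl⟩)) 6 x y (detS x y h)

/-- An edge that goes up from level `k` is the `k`-th connecting edge. -/
lemma adj_up {r : ℕ} (hr : 1 ≤ r) {a b : VL r} (h : (Lgraph r).Adj a b) (k : Fin (r + 1))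
    (ha : lev a ≤ k) (hb : (k : ℕ) < lev b) : a = lft k ∧ b = rgt k := by
  rw [L_adj hr] at h
  rcases h with h | ⟨j, rfl, rfl⟩ | ⟨j, rfl, rfl⟩
  · have := h.lev_eq
    omega
  · rw [lev_lft] at ha
    rw [lev_rgt] at hb
    have : j = k := Fin.ext (by omega)
    subst this
    exact ⟨rfl, rfl⟩
  · rw [lev_rgt] at ha
    rw [lev_lft] at hb
    omega

lemma link_bridge {r : ℕ} (hr : 1 ≤ r) (k : Fin (r + 1)) :
    (Lgraph r).IsBridge s(lft k, rgt k) := by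
  rw [isBridge_iff]
  intro h
  have := reachable_closed {v | lev v ≤ k} (fun a b hab ha => ?_) h (lev_lft k).le
  · rw [Set.mem_ofPred_eq, lev_rgt] at this
    omega
  · rw [deleteEdges_adj] at hab
    by_contra hb
    obtain ⟨rfl, rfl⟩ := adj_up hr hab.1 k ha (not_le.1 hb)
    exact hab.2 rfl

lemma L_bridges {r : ℕ} (hr : 1 ≤ r) :
    {e : Sym2 (VL r) | (Lgraph r).IsBridge e}.ncard = r + 1 := by
  have : {e : Sym2 (VL r) | (Lgraph r).IsBridge e} =
      Set.range (fun k : Fin (r + 1) => s(lft k, rgt k)) := by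
    ext e
    constructor
    · induction e using Sym2.ind with
      | _ a b =>
        intro h
        have h' : (Lgraph r).IsBridge s(a, b) := h
        have hab := h'.reachable_iff_adj.1 ((L_connected hr).preconnected a b)
        rw [L_adj hr] at hab
        rcases hab with hab | ⟨k, rfl, rfl⟩ | ⟨k, rfl, rfl⟩
        · exact (intra_not_bridge hr hab h').elim
        · exact ⟨k, rfl⟩
        · exact ⟨k, Sym2.eq_swap⟩
    · rintro ⟨k, rfl⟩
      exact link_bridge hr k
  have hinj : Function.Injective (fun k : Fin (r + 1) => (s(lft k, rgt k) : Sym2 (VL r))) := by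
    intro j k h
    rcases Sym2.eq_iff.1 h with ⟨h1, -⟩ | ⟨h1, h2⟩
    · have := congrArg lev h1
      rw [lev_lft, lev_lft] at this
      exact Fin.ext this
    · have h1 := congrArg lev h1
      have h2 := congrArg lev h2
      rw [lev_lft, lev_rgt] at h1
      rw [lev_rgt, lev_lft] at h2
      omega
  rw [this, ← Set.image_univ, Set.ncard_image_of_injective _ hinj, Set.ncard_univ]
  simp

lemma L_cut {r : ℕ} (hr : 1 ≤ r) :
    ¬ ((Lgraph r).induce (({lft 0} : Set (VL r))ᶜ)).Connected := by
  intro h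
  have ha : (Sum.inr (Sum.inl (Sum.inl (Sum.inl 0))) : VL r) ∈ (({lft 0} : Set (VL r))ᶜ) := by
    simp [lft_zero]
  have hb : (Sum.inr (Sum.inr (Sum.inr 0)) : VL r) ∈ (({lft 0} : Set (VL r))ᶜ) := by
    simp [lft_zero]
  have := reachable_closed {v | lev v.1 ≤ 0} (fun a b hab ha => ?_)
    (h.preconnected ⟨_, ha⟩ ⟨_, hb⟩) (le_refl 0)
  · simp [lev] at this
  · by_contra hb
    have hab' : (Lgraph r).Adj a.1 b.1 := hab
    exact a.2 (adj_up hr hab' 0 ha (not_le.1 hb)).1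

/-- For every `r ≥ 1`, the graph `L_r` is cubic, has `20r + 34` vertices,
`γ(L_r) = 7r + 12`, has exactly `r + 1` bridges (so it is connected but not 2-connected), and
`γ(L_r) > ⌈(20r + 34)/3⌉`. -/
theorem stmt_7 (r : ℕ) (hr : 1 ≤ r) :
    IsCubic (Lgraph r) ∧
    Nat.card ((Fin r × VP) ⊕ (VS ⊕ VS)) = 20 * r + 34 ∧
    domNum (Lgraph r) = 7 * r + 12 ∧
    {e : Sym2 ((Fin r × VP) ⊕ (VS ⊕ VS)) | (Lgraph r).IsBridge e}.ncard = r + 1 ∧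
    (Lgraph r).Connected ∧
    (∃ v : (Fin r × VP) ⊕ (VS ⊕ VS),
      ¬ ((Lgraph r).induce (({v} : Set ((Fin r × VP) ⊕ (VS ⊕ VS)))ᶜ)).Connected) ∧
    ⌈(20 * r + 34 : ℚ) / 3⌉₊ < 7 * r + 12 := by
  refine ⟨L_cubic hr, ?_, L_domNum hr, L_bridges hr, L_connected hr, ⟨lft 0, L_cut hr⟩, ?_⟩
  · simp
    ring
  · have h : ⌈(20 * r + 34 : ℚ) / 3⌉₊ ≤ 7 * r + 11 := by
      rw [Nat.ceil_le]
      push_cast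
      have : (1 : ℚ) ≤ r := by exact_mod_cast hr
      linarith
    omega
end

section
/- Let G be a finite connected simple cubic graph with 2k vertices. Then the graph G(P,B) has 78k vertices and γ(G(P,B)) = 27k; in particular γ(G(P,B)) > ⌈78k/3⌉ = 26k. -/
open SimpleGraph

/-- The roots `b1 = 6`, `b2 = 7`, `b3 = 8` of the graph `B`. -/
def broot (j : Fin 3) : Fin 9 := ⟨6 + j.val, by omega⟩

/-- The graph `G(P,B)`, obtained from `G` by replacing each vertex by a disjoint copy of
`(B, {b1, b2, b3})` and each edge by a disjoint copy of `(P', {p1', p2'})`.  The endpoints of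
each edge `e` are `fst e` and `snd e`; the copy of `P` carried by `e` is attached, via `p1`,
to the root `b_{r1 e}` of the copy of `B` replacing `fst e` and, via `p2`, to the root
`b_{r2 e}` of the copy of `B` replacing `snd e`. -/
def GPBgraph {V : Type*} (G : SimpleGraph V) (fst snd : G.edgeSet → V)
    (r1 r2 : G.edgeSet → Fin 3) :
    SimpleGraph ((V × Fin 9) ⊕ (G.edgeSet × VP)) :=
  SimpleGraph.fromRel (fun a b =>
    (∃ (v : V) (x y : Fin 9), graphB.Adj x y ∧
      a = Sum.inl (v, x) ∧ b = Sum.inl (v, y)) ∨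
    (∃ (e : G.edgeSet) (x y : VP), graphP.Adj x y ∧
      a = Sum.inr (e, x) ∧ b = Sum.inr (e, y)) ∨
    (∃ e : G.edgeSet, a = Sum.inl (fst e, broot (r1 e)) ∧ b = Sum.inr (e, Sum.inr 0)) ∨
    (∃ e : G.edgeSet, a = Sum.inl (snd e, broot (r2 e)) ∧ b = Sum.inr (e, Sum.inr 1)))

def listA : List (Fin 8 × Fin 8) :=
  [(6, 0), (6, 3), (7, 0), (7, 4), (0, 5), (1, 3), (1, 4), (1, 5), (2, 3), (2, 4), (2, 5)]

def listB : List (Fin 9 × Fin 9) :=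
  [(6, 0), (6, 3), (7, 0), (7, 4), (8, 0), (8, 5),
   (1, 3), (1, 4), (1, 5), (2, 3), (2, 4), (2, 5)]

def adjA (x y : Fin 8) : Bool := decide ((x, y) ∈ listA) || decide ((y, x) ∈ listA)
def adjB (x y : Fin 9) : Bool := decide ((x, y) ∈ listB) || decide ((y, x) ∈ listB)

lemma graphA_iff (x y : Fin 8) : graphA.Adj x y ↔ adjA x y = true := by
  simp only [graphA, SimpleGraph.fromEdgeSet_adj, Set.mem_insert_iff, Set.mem_singleton_iff,
    Sym2.eq_iff]
  revert x y
  decide +kernel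

lemma graphB_iff (x y : Fin 9) : graphB.Adj x y ↔ adjB x y = true := by
  simp only [graphB, SimpleGraph.fromEdgeSet_adj, Set.mem_insert_iff, Set.mem_singleton_iff,
    Sym2.eq_iff]
  revert x y
  decide +kernel

lemma A_lb : ∀ S : Finset (Fin 8),
    (∀ v : Fin 8, v < 6 → v ∉ S → ∃ u ∈ S, adjA u v = true) →
    2 ≤ S.card ∧ (S.card = 2 →
      (6 ∉ S ∧ ¬ ∃ u ∈ S, adjA u 6 = true) ∧ (7 ∉ S ∧ ¬ ∃ u ∈ S, adjA u 7 = true)) := by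
  decide +kernel

lemma B_lb : ∀ S : Finset (Fin 9),
    (∀ v : Fin 9, v < 6 → v ∉ S → ∃ u ∈ S, adjB u v = true) → 3 ≤ S.card := by
  decide +kernel

lemma Z_lb : ∀ S : Finset (Fin 4),
    ((0 ∈ S ∨ 1 ∈ S ∨ 2 ∈ S ∨ 3 ∈ S) → 1 ≤ S.card) ∧
    ((0 ∈ S ∧ 3 ∈ S) → 2 ≤ S.card) ∧ ((1 ∈ S ∧ 3 ∈ S) → 2 ≤ S.card) ∧
    ((0 ∈ S ∧ 1 ∈ S ∧ 3 ∈ S) → 3 ≤ S.card) := by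
  decide +kernel

lemma P_lb (X Y : Finset (Fin 8)) (Z : Finset (Fin 4))
    (hX : ∀ v : Fin 8, v < 6 → v ∉ X → ∃ u ∈ X, adjA u v = true)
    (hY : ∀ v : Fin 8, v < 6 → v ∉ Y → ∃ u ∈ Y, adjA u v = true)
    (hX6 : 6 ∉ X → (∃ u ∈ X, adjA u 6 = true) ∨ 0 ∈ Z)
    (hX7 : 7 ∉ X → (∃ u ∈ X, adjA u 7 = true) ∨ 3 ∈ Z)
    (hY6 : 6 ∉ Y → (∃ u ∈ Y, adjA u 6 = true) ∨ 1 ∈ Z)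
    (hY7 : 7 ∉ Y → (∃ u ∈ Y, adjA u 7 = true) ∨ 3 ∈ Z)
    (hZ : 0 ∈ Z ∨ 1 ∈ Z ∨ 2 ∈ Z ∨ 3 ∈ Z) : 7 ≤ X.card + Y.card + Z.card := by
  obtain ⟨a1, a2⟩ := A_lb X hX
  obtain ⟨b1, b2⟩ := A_lb Y hY
  obtain ⟨z1, z2, z3, z4⟩ := Z_lb Z
  have z1 := z1 hZ
  by_cases ca : X.card = 2
  · obtain ⟨⟨p, q⟩, r, s⟩ := a2 ca
    have h0 := (hX6 p).resolve_left q
    have h3 := (hX7 r).resolve_left s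
    have := z2 ⟨h0, h3⟩
    by_cases cb : Y.card = 2
    · obtain ⟨⟨p, q⟩, r, s⟩ := b2 cb
      have h1 := (hY6 p).resolve_left q
      have := z4 ⟨h0, h1, h3⟩
      omega
    · omega
  · by_cases cb : Y.card = 2
    · obtain ⟨⟨p, q⟩, r, s⟩ := b2 cb
      have h1 := (hY6 p).resolve_left q
      have h3 := (hY7 r).resolve_left s
      have := z3 ⟨h1, h3⟩
      omega
    · omega

lemma P_adj_X (a : VP) (v : Fin 8) (h : graphP.Adj a (Sum.inl (Sum.inl v))) :
    (∃ u, a = Sum.inl (Sum.inl u) ∧ adjA u v = true) ∨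
    (v = 6 ∧ a = Sum.inr 0) ∨ (v = 7 ∧ a = Sum.inr 3) := by
  simp only [← graphA_iff]
  rcases a with (a | a) | a <;> simp [graphP, F2graph, graphA.adj_comm] at h ⊢ <;> tauto

lemma P_adj_Y (a : VP) (v : Fin 8) (h : graphP.Adj a (Sum.inl (Sum.inr v))) :
    (∃ u, a = Sum.inl (Sum.inr u) ∧ adjA u v = true) ∨
    (v = 6 ∧ a = Sum.inr 1) ∨ (v = 7 ∧ a = Sum.inr 3) := by
  simp only [← graphA_iff]
  rcases a with (a | a) | a <;> simp [graphP, F2graph, graphA.adj_comm] at h ⊢ <;> tauto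

lemma P_adj_Z (a : VP) (h : graphP.Adj a (Sum.inr 2)) :
    a = Sum.inr 0 ∨ a = Sum.inr 1 ∨ a = Sum.inr 3 := by
  rcases a with (a | a) | a <;> simp [graphP, F2graph] at h ⊢ <;> tauto

section
variable {V : Type*} (G : SimpleGraph V) (fst snd : G.edgeSet → V) (r1 r2 : G.edgeSet → Fin 3)

lemma GPB_adj_B (a) (v : V) (x : Fin 9) (hx : x < 6)
    (h : (GPBgraph G fst snd r1 r2).Adj a (Sum.inl (v, x))) :
    ∃ y, a = Sum.inl (v, y) ∧ adjB y x = true := by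
  simp only [← graphB_iff]
  have hb : ∀ j, x ≠ broot j := by
    intro j hj
    subst hj
    simp [broot, Fin.lt_def] at hx
  rcases a with ⟨w, y⟩ | ⟨e, y⟩ <;> simp [GPBgraph, hb, graphB.adj_comm] at h ⊢ <;> tauto

lemma GPB_adj_P (a) (e : G.edgeSet) (x : VP) (h0 : x ≠ Sum.inr 0) (h1 : x ≠ Sum.inr 1)
    (h : (GPBgraph G fst snd r1 r2).Adj a (Sum.inr (e, x))) :
    ∃ y, a = Sum.inr (e, y) ∧ graphP.Adj y x := by
  unfold GPBgraph at h
  rw [SimpleGraph.fromRel_adj] at h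
  obtain ⟨-, h | h⟩ := h
  · rcases h with ⟨_, _, _, _, _, h⟩ | ⟨e', x', y', h, h2, h3⟩ | ⟨_, _, h⟩ | ⟨_, _, h⟩
    · cases h
    · cases h3
      exact ⟨_, h2, h⟩
    · cases h
      exact absurd rfl h0
    · cases h
      exact absurd rfl h1
  · rcases h with ⟨_, _, _, _, h, _⟩ | ⟨e', x', y', h, h2, h3⟩ | ⟨_, h, _⟩ | ⟨_, h, _⟩
    · cases h
    · cases h2
      exact ⟨_, h3, h.symm⟩
    · cases h
    · cases h

lemma GPB_adj_of_B (v : V) (x y : Fin 9) (h : adjB x y = true) :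
    (GPBgraph G fst snd r1 r2).Adj (Sum.inl (v, x)) (Sum.inl (v, y)) := by
  have h := (graphB_iff x y).2 h
  unfold GPBgraph
  rw [SimpleGraph.fromRel_adj]
  refine ⟨?_, Or.inl (Or.inl ⟨v, x, y, h, rfl, rfl⟩)⟩
  intro h'
  cases h'
  exact h.ne rfl

lemma GPB_adj_of_P (e : G.edgeSet) (x y : VP) (h : graphP.Adj x y) :
    (GPBgraph G fst snd r1 r2).Adj (Sum.inr (e, x)) (Sum.inr (e, y)) := by
  unfold GPBgraph
  rw [SimpleGraph.fromRel_adj]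
  refine ⟨?_, Or.inl (Or.inr (Or.inl ⟨e, x, y, h, rfl, rfl⟩))⟩
  intro h'
  cases h'
  exact h.ne rfl

end

lemma B_ub : ∀ x : Fin 9, x ∉ ({0, 1, 2} : Finset (Fin 9)) →
    ∃ y ∈ ({0, 1, 2} : Finset (Fin 9)), adjB y x = true := by
  decide +kernel

lemma A_ub : ∀ x : Fin 8, x ∉ ({0, 1, 2} : Finset (Fin 8)) →
    ∃ y ∈ ({0, 1, 2} : Finset (Fin 8)), adjA y x = true := by
  decide +kernel

/-- Minimum dominating set of `P`. -/
def domP_s10 : VP → Prop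
  | Sum.inl (Sum.inl x) => x ∈ ({0, 1, 2} : Finset (Fin 8))
  | Sum.inl (Sum.inr x) => x ∈ ({0, 1, 2} : Finset (Fin 8))
  | Sum.inr z => z = 2

lemma P_ub (x : VP) (hx : ¬ domP_s10 x) : ∃ y, domP_s10 y ∧ graphP.Adj y x := by
  rcases x with (x | x) | x
  · obtain ⟨y, hy, h⟩ := A_ub x hx
    have h := (graphA_iff _ _).2 h
    exact ⟨Sum.inl (Sum.inl y), hy, by simp [graphP, F2graph, h, h.ne]⟩
  · obtain ⟨y, hy, h⟩ := A_ub x hx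
    have h := (graphA_iff _ _).2 h
    exact ⟨Sum.inl (Sum.inr y), hy, by simp [graphP, F2graph, h, h.ne]⟩
  · refine ⟨Sum.inr 2, rfl, ?_⟩
    have hx : x ≠ 2 := hx
    fin_cases x <;> simp [graphP, F2graph] at hx ⊢

/-- Dominating set of the whole graph. -/
def domAll (V E : Type*) : (V × Fin 9) ⊕ (E × VP) → Prop
  | Sum.inl p => p.2 ∈ ({0, 1, 2} : Finset (Fin 9))
  | Sum.inr p => domP_s10 p.2

open Classical in
lemma ncard_formula {V E : Type*} [Fintype V] [Fintype E]
    (D : Set ((V × Fin 9) ⊕ (E × VP))) :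
    D.ncard = (∑ v : V, (Finset.univ.filter (fun i : Fin 9 => Sum.inl (v, i) ∈ D)).card) +
      ∑ e : E, ((Finset.univ.filter (fun i : Fin 8 => Sum.inr (e, Sum.inl (Sum.inl i)) ∈ D)).card
        + (Finset.univ.filter (fun i : Fin 8 => Sum.inr (e, Sum.inl (Sum.inr i)) ∈ D)).card
        + (Finset.univ.filter (fun i : Fin 4 => Sum.inr (e, Sum.inr i) ∈ D)).card) := by
  have : D.ncard = ∑ w, if w ∈ D then 1 else 0 := by
    rw [Set.ncard_eq_toFinset_card', ← Finset.card_filter]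
    congr 1
    ext w
    simp
  rw [this, Fintype.sum_sum_type, Fintype.sum_prod_type, Fintype.sum_prod_type]
  simp only [Finset.card_filter, Fintype.sum_sum_type]

/-- Let `G` be a finite connected simple cubic graph with `2k` vertices.
Then `G(P,B)` has `78k` vertices and `γ(G(P,B)) = 27k`; in particular
`γ(G(P,B)) > ⌈78k/3⌉ = 26k`.  The hypothesis `hports` says that at each vertex `v` of `G` the
three edge-ends incident with `v` are matched bijectively with the three roots `b1, b2, b3` of
the copy of `B` replacing `v`. -/
theorem stmt_10 {V : Type*} [Fintype V] (G : SimpleGraph V) (k : ℕ)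
    (hconn : G.Connected) (hcub : IsCubic G) (hcard : Fintype.card V = 2 * k)
    (fst snd : G.edgeSet → V)
    (hends : ∀ e : G.edgeSet, s(fst e, snd e) = (e : Sym2 V))
    (r1 r2 : G.edgeSet → Fin 3)
    (hports : ∀ (v : V) (j : Fin 3), ∃! p : G.edgeSet × Bool,
      (p.2 = true ∧ fst p.1 = v ∧ r1 p.1 = j) ∨
      (p.2 = false ∧ snd p.1 = v ∧ r2 p.1 = j)) :
    Nat.card ((V × Fin 9) ⊕ (G.edgeSet × VP)) = 78 * k ∧
    domNum (GPBgraph G fst snd r1 r2) = 27 * k ∧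
    ⌈(78 * k : ℚ) / 3⌉₊ = 26 * k ∧ 26 * k < 27 * k := by
  classical
  have hE : Fintype.card G.edgeSet = 3 * k := by
    let f : G.edgeSet × Bool → V × Fin 3 := fun p =>
      if p.2 = true then (fst p.1, r1 p.1) else (snd p.1, r2 p.1)
    have key : ∀ p v j, f p = (v, j) ↔ (p.2 = true ∧ fst p.1 = v ∧ r1 p.1 = j) ∨
        (p.2 = false ∧ snd p.1 = v ∧ r2 p.1 = j) := by
      rintro ⟨e, b⟩ v j
      cases b <;> simp [f]
    have hf : Function.Bijective f := by
      rw [Function.bijective_iff_existsUnique]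
      rintro ⟨v, j⟩
      simp only [key]
      exact hports v j
    have := Fintype.card_of_bijective hf
    simp only [Fintype.card_prod, Fintype.card_bool, Fintype.card_fin, hcard] at this
    omega
  have hk : 0 < k := by
    have := hconn.nonempty
    have := Fintype.card_pos (α := V)
    omega
  refine ⟨?_, ?_, ?_, by omega⟩
  · simp only [Nat.card_eq_fintype_card, Fintype.card_sum, Fintype.card_prod, Fintype.card_fin,
      hcard, hE]
    omega
  · unfold domNum
    apply le_antisymm
    · apply Nat.sInf_le
      refine ⟨{w | domAll V G.edgeSet w}, ?_, ?_⟩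
      · rintro (⟨v, x⟩ | ⟨e, x⟩) hx
        · obtain ⟨y, hy, h⟩ := B_ub x hx
          exact ⟨Sum.inl (v, y), hy, GPB_adj_of_B _ _ _ _ _ _ _ _ h⟩
        · obtain ⟨y, hy, h⟩ := P_ub x hx
          exact ⟨Sum.inr (e, y), hy, GPB_adj_of_P _ _ _ _ _ _ _ _ h⟩
      · rw [ncard_formula]
        have h9 : ({0, 1, 2} : Finset (Fin 9)).card = 3 := by decide
        have h8 : ({0, 1, 2} : Finset (Fin 8)).card = 3 := by decide
        have e1 : ∀ v : V, (Finset.univ.filter (fun i : Fin 9 =>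
            Sum.inl (v, i) ∈ {w | domAll V G.edgeSet w})).card = 3 := by
          intro v
          rw [← h9]
          congr 1
          ext i
          rw [Finset.mem_filter]
          exact ⟨fun h => h.2, fun h => ⟨Finset.mem_univ _, h⟩⟩
        have e2 : ∀ e : G.edgeSet, (Finset.univ.filter (fun i : Fin 8 =>
            Sum.inr (e, Sum.inl (Sum.inl i)) ∈ {w | domAll V G.edgeSet w})).card = 3 := by
          intro v
          rw [← h8]
          congr 1
          ext i
          rw [Finset.mem_filter]
          exact ⟨fun h => h.2, fun h => ⟨Finset.mem_univ _, h⟩⟩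
        have e3 : ∀ e : G.edgeSet, (Finset.univ.filter (fun i : Fin 8 =>
            Sum.inr (e, Sum.inl (Sum.inr i)) ∈ {w | domAll V G.edgeSet w})).card = 3 := by
          intro v
          rw [← h8]
          congr 1
          ext i
          rw [Finset.mem_filter]
          exact ⟨fun h => h.2, fun h => ⟨Finset.mem_univ _, h⟩⟩
        have e4 : ∀ e : G.edgeSet, (Finset.univ.filter (fun i : Fin 4 =>
            Sum.inr (e, Sum.inr i) ∈ {w | domAll V G.edgeSet w})).card = 1 := by
          intro v
          rw [← Finset.card_singleton (2 : Fin 4)]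
          congr 1
          ext i
          rw [Finset.mem_filter, Finset.mem_singleton]
          exact ⟨fun h => h.2, fun h => ⟨Finset.mem_univ _, h⟩⟩
        simp only [e1, e2, e3, e4]
        simp only [Finset.sum_const, Finset.card_univ, hcard, hE, smul_eq_mul]
        omega
    · refine le_csInf ⟨_, Set.univ, fun v hv => absurd (Set.mem_univ v) hv, rfl⟩ ?_
      rintro n ⟨D, hD, rfl⟩
      rw [ncard_formula]
      have h1 : Fintype.card V * 3 ≤
          ∑ v : V, (Finset.univ.filter (fun i : Fin 9 => Sum.inl (v, i) ∈ D)).card := by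
        rw [← smul_eq_mul, ← Finset.card_univ]
        apply Finset.card_nsmul_le_sum
        intro v _
        apply B_lb
        intro x hx hxD
        obtain ⟨u, hu, hadj⟩ := hD (Sum.inl (v, x)) (by simpa using hxD)
        obtain ⟨y, rfl, hy⟩ := GPB_adj_B _ _ _ _ _ _ _ _ hx hadj
        exact ⟨y, by simpa using hu, hy⟩
      have h2 : Fintype.card G.edgeSet * 7 ≤ ∑ e : G.edgeSet,
          ((Finset.univ.filter (fun i : Fin 8 => Sum.inr (e, Sum.inl (Sum.inl i)) ∈ D)).card
          + (Finset.univ.filter (fun i : Fin 8 => Sum.inr (e, Sum.inl (Sum.inr i)) ∈ D)).card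
          + (Finset.univ.filter (fun i : Fin 4 => Sum.inr (e, Sum.inr i) ∈ D)).card) := by
        rw [← smul_eq_mul, ← Finset.card_univ]
        apply Finset.card_nsmul_le_sum
        intro e _
        have hX : ∀ x : Fin 8, Sum.inr (e, Sum.inl (Sum.inl x)) ∉ D →
            (∃ u, Sum.inr (e, Sum.inl (Sum.inl u)) ∈ D ∧ adjA u x = true) ∨
            (x = 6 ∧ Sum.inr (e, Sum.inr 0) ∈ D) ∨ (x = 7 ∧ Sum.inr (e, Sum.inr 3) ∈ D) := by
          intro x hx
          obtain ⟨u, hu, hadj⟩ := hD _ hx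
          obtain ⟨y, rfl, hy⟩ := GPB_adj_P _ _ _ _ _ _ _ _ (by simp) (by simp) hadj
          rcases P_adj_X _ _ hy with ⟨u, rfl, h⟩ | ⟨h, rfl⟩ | ⟨h, rfl⟩
          · exact Or.inl ⟨u, hu, h⟩
          · exact Or.inr (Or.inl ⟨h, hu⟩)
          · exact Or.inr (Or.inr ⟨h, hu⟩)
        have hY : ∀ x : Fin 8, Sum.inr (e, Sum.inl (Sum.inr x)) ∉ D →
            (∃ u, Sum.inr (e, Sum.inl (Sum.inr u)) ∈ D ∧ adjA u x = true) ∨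
            (x = 6 ∧ Sum.inr (e, Sum.inr 1) ∈ D) ∨ (x = 7 ∧ Sum.inr (e, Sum.inr 3) ∈ D) := by
          intro x hx
          obtain ⟨u, hu, hadj⟩ := hD _ hx
          obtain ⟨y, rfl, hy⟩ := GPB_adj_P _ _ _ _ _ _ _ _ (by simp) (by simp) hadj
          rcases P_adj_Y _ _ hy with ⟨u, rfl, h⟩ | ⟨h, rfl⟩ | ⟨h, rfl⟩
          · exact Or.inl ⟨u, hu, h⟩
          · exact Or.inr (Or.inl ⟨h, hu⟩)
          · exact Or.inr (Or.inr ⟨h, hu⟩)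
        apply P_lb <;> simp only [Finset.mem_filter, Finset.mem_univ, true_and]
        · intro x hx hxD
          rcases hX x hxD with h | ⟨rfl, -⟩ | ⟨rfl, -⟩
          · exact h
          · exact absurd hx (by decide)
          · exact absurd hx (by decide)
        · intro x hx hxD
          rcases hY x hxD with h | ⟨rfl, -⟩ | ⟨rfl, -⟩
          · exact h
          · exact absurd hx (by decide)
          · exact absurd hx (by decide)
        · intro h
          rcases hX _ h with h | ⟨-, h⟩ | ⟨h', h⟩
          · exact Or.inl h
          · exact Or.inr h
          · exact absurd h' (by decide)
        · intro h
          rcases hX _ h with h | ⟨h', h⟩ | ⟨-, h⟩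
          · exact Or.inl h
          · exact absurd h' (by decide)
          · exact Or.inr h
        · intro h
          rcases hY _ h with h | ⟨-, h⟩ | ⟨h', h⟩
          · exact Or.inl h
          · exact Or.inr h
          · exact absurd h' (by decide)
        · intro h
          rcases hY _ h with h | ⟨h', h⟩ | ⟨-, h⟩
          · exact Or.inl h
          · exact absurd h' (by decide)
          · exact Or.inr h
        · by_cases h : Sum.inr (e, Sum.inr 2) ∈ D
          · exact Or.inr (Or.inr (Or.inl h))
          · obtain ⟨u, hu, hadj⟩ := hD _ h
            obtain ⟨y, rfl, hy⟩ := GPB_adj_P _ _ _ _ _ _ _ _ (by simp) (by simp) hadj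
            rcases P_adj_Z _ hy with rfl | rfl | rfl
            · exact Or.inl hu
            · exact Or.inr (Or.inl hu)
            · exact Or.inr (Or.inr (Or.inr hu))
      rw [hcard] at h1
      rw [hE] at h2
      omega
  · have : (78 * k : ℚ) / 3 = ((26 * k : ℕ) : ℚ) := by
      push_cast
      ring
    rw [this, Nat.ceil_natCast]
end
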